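/- Let Q = q^2 where q is a power of p, and m = 2, with N_1 − 1 and N_2 − 1 dividing q^2 − 1. Let J ⊆ {1,2} and assume that p divides N_j for each j ∉ J. For i = 1, 2 set r_q(N_i) = ⌊(N_i − 1)/(q + 1)⌋ if q + 1 does not divide N_i − 1, and r_q(N_i) = (N_i − 1)/(q + 1) − 1 otherwise. Let t ≤ n_J be a positive integer and suppose one of the following holds: (i) J = ∅ and (t ≤ r_q(N_1) + 2 or t ≤ r_q(N_2) + 2); (ii) J = {1} and (t ≤ r_q(N_1) + 1 or t ≤ r_q(N_2) + 2); (iii) J = {1,2} and (t ≤ r_q(N_1) + 1 or t ≤ r_q(N_2) + 1). Then F(J,t) ⊆ F(J,t)^{⊥_h} (Hermitian duality), dim_{F_{q^2}} F(J,t) = card(N(J,t)), and every nonzero codeword of F(J,t)^{⊥_h} has Hamming weight at least t. -/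

import Mathlib

/-- `ε_j = 1` if `j ∈ J` and `0` otherwise. -/
def eps {m : ℕ} (J : Finset (Fin m)) (j : Fin m) : ℕ := if j ∈ J then 1 else 0

/-- The points `Z_J` of the `J`-affine variety. -/
def ZJ (F : Type) [Field F] [Fintype F] [DecidableEq F] {m : ℕ} (N : Fin m → ℕ)
    (J : Finset (Fin m)) : Finset (Fin m → F) :=
  Finset.univ.filter
    (fun x => ∀ j, (j ∈ J → x j ^ (N j - 1) = 1) ∧ (j ∉ J → x j ^ (N j) = x j))

/-- Evaluation of the monomial `X^b` at all the points of `Z_J`. -/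
def evm (F : Type) [Field F] [Fintype F] [DecidableEq F] {m : ℕ} (N : Fin m → ℕ)
    (J : Finset (Fin m)) (b : Fin m → ℕ) : ↥(ZJ F N J) → F :=
  fun P => ∏ j, P.1 j ^ b j

/-- The set `N(J,t)` of exponent tuples. -/
def NSet {m : ℕ} (N : Fin m → ℕ) (J : Finset (Fin m)) (t : ℕ) : Set (Fin m → ℕ) :=
  { b | (∀ j, eps J j ≤ b j ∧ b j ≤ N j - 1) ∧ ∏ j, (b j + 1 - eps J j) < t }

/-- The code `F(J,t)`: the span of the evaluations of the monomials with exponents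
in `N(J,t)`. -/
noncomputable def Fcode (F : Type) [Field F] [Fintype F] [DecidableEq F] {m : ℕ}
    (N : Fin m → ℕ) (J : Finset (Fin m)) (t : ℕ) : Submodule F (↥(ZJ F N J) → F) :=
  Submodule.span F { v | ∃ b ∈ NSet N J t, v = evm F N J b }

/-- `r_q(N_i) = ⌊(N_i − 1)/(q + 1)⌋` if `q + 1` does not divide `N_i − 1`, and
`(N_i − 1)/(q + 1) − 1` otherwise. -/
def rNq (q n : ℕ) : ℕ := if (q + 1) ∣ (n - 1) then (n - 1) / (q + 1) - 1 else (n - 1) / (q + 1)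

section RootsOfUnityInFiniteField

variable {F : Type} [Field F] [Fintype F] [DecidableEq F]

theorem exists_isPrimitiveRoot_of_dvd_card_sub_one {d : ℕ} (hd : d ∣ Fintype.card F - 1) :
    ∃ ζ : F, IsPrimitiveRoot ζ d := by
  obtain ⟨g, hg⟩ := IsCyclic.exists_generator (α := Fˣ)
  have hord := orderOf_eq_card_of_forall_mem_zpowers hg
  rw [Nat.card_eq_fintype_card, Fintype.card_units] at hord
  have hgp : IsPrimitiveRoot g (Fintype.card F - 1) := hord ▸ IsPrimitiveRoot.orderOf g
  obtain ⟨k, hk⟩ := hd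
  have hpos : 0 < Fintype.card F - 1 := by
    have := Fintype.one_lt_card (α := F)
    omega
  have := hgp.pow hpos (a := k) (b := d) (by rw [hk, mul_comm])
  exact ⟨_, this.map_of_injective (f := Units.coeHom F) Units.val_injective⟩

theorem card_filter_pow_eq_one {d : ℕ} (hd0 : 0 < d) (hd : d ∣ Fintype.card F - 1) :
    (Finset.univ.filter (fun x : F => x ^ d = 1)).card = d := by
  obtain ⟨ζ, hζ⟩ := exists_isPrimitiveRoot_of_dvd_card_sub_one hd
  rw [← hζ.card_nthRootsFinset]
  congr 1
  ext x
  rw [hζ.card_nthRootsFinset]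
  simp [Polynomial.mem_nthRootsFinset hd0]

theorem sum_pow_filter_pow_eq_one {d c : ℕ} (hd : d ∣ Fintype.card F - 1) (hc0 : 0 < c)
    (hcd : c < d) : ∑ x ∈ Finset.univ.filter (fun x : F => x ^ d = 1), x ^ c = 0 := by
  obtain ⟨ζ, hζ⟩ := exists_isPrimitiveRoot_of_dvd_card_sub_one hd
  have hζ0 : ζ ≠ 0 := hζ.ne_zero (by omega)
  have hmul : ζ ^ c * ∑ x ∈ Finset.univ.filter (fun x : F => x ^ d = 1), x ^ c
      = ∑ x ∈ Finset.univ.filter (fun x : F => x ^ d = 1), x ^ c := by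
    rw [Finset.mul_sum]
    refine Finset.sum_bij' (fun x _ => ζ * x) (fun x _ => ζ⁻¹ * x) ?_ ?_ ?_ ?_ ?_
    · intro x hx
      simp_all [mul_pow, hζ.pow_eq_one]
    · intro x hx
      simp_all [mul_pow, hζ.pow_eq_one]
    · intro x _
      field_simp
    · intro x _
      field_simp
    · intro x _
      rw [mul_pow]
  have hne := hζ.pow_ne_one_of_pos_of_lt hc0.ne' hcd
  have : (ζ ^ c - 1) * ∑ x ∈ Finset.univ.filter (fun x : F => x ^ d = 1), x ^ c = 0 := by
    rw [sub_mul, hmul, one_mul, sub_self]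
  exact (mul_eq_zero.mp this).resolve_left (sub_ne_zero.mpr hne)

theorem filter_pow_eq_self {n : ℕ} (hn : 1 < n) :
    Finset.univ.filter (fun x : F => x ^ n = x)
      = insert 0 (Finset.univ.filter (fun x : F => x ^ (n - 1) = 1)) := by
  ext x
  obtain ⟨k, rfl⟩ : ∃ k, n = k + 2 := ⟨n - 2, by omega⟩
  by_cases hx : x = 0
  · simp [hx]
  · simp [hx, pow_succ x (k + 1)]

theorem zero_notMem_filter_pow_eq_one {d : ℕ} (hd : 0 < d) :
    (0 : F) ∉ Finset.univ.filter (fun x : F => x ^ d = 1) := by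
  simp [hd.ne']

end RootsOfUnityInFiniteField

section AffineVariety

variable (F : Type) [Field F] [Fintype F] [DecidableEq F] {m : ℕ} (N : Fin m → ℕ)
  (J : Finset (Fin m))

/-- The set of values taken by the `j`-th coordinate on `Z_J`. -/
def ZCoord (j : Fin m) : Finset F :=
  if j ∈ J then Finset.univ.filter (fun x => x ^ (N j - 1) = 1)
  else Finset.univ.filter (fun x => x ^ N j = x)

theorem ZJ_eq_piFinset : ZJ F N J = Fintype.piFinset (ZCoord F N J) := by
  ext x
  simp only [ZJ, ZCoord, Finset.mem_filter, Finset.mem_univ, true_and, Fintype.mem_piFinset]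
  refine forall_congr' fun j => ?_
  by_cases hj : j ∈ J <;> simp [hj]

theorem sum_evm (c : Fin m → ℕ) :
    ∑ P, evm F N J c P = ∏ j, ∑ x ∈ ZCoord F N J j, x ^ c j := by
  rw [Finset.prod_univ_sum, ← ZJ_eq_piFinset]
  exact Finset.sum_coe_sort (ZJ F N J) (fun P => ∏ j, P j ^ c j)

variable {F N J}

theorem card_ZCoord {j : Fin m} (hN : 1 < N j) (hdvd : N j - 1 ∣ Fintype.card F - 1) :
    (ZCoord F N J j).card = N j - eps J j := by
  have h1 := card_filter_pow_eq_one (F := F) (Nat.sub_pos_of_lt hN) hdvd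
  by_cases hj : j ∈ J
  · simpa [ZCoord, eps, hj] using h1
  · simp only [ZCoord, eps, hj, if_false]
    rw [filter_pow_eq_self hN, Finset.card_insert_of_notMem
      (zero_notMem_filter_pow_eq_one (Nat.sub_pos_of_lt hN)), h1]
    omega

theorem card_ZJ (hN : ∀ j, 1 < N j) (hdvd : ∀ j, N j - 1 ∣ Fintype.card F - 1) :
    (ZJ F N J).card = ∏ j, (N j - eps J j) := by
  rw [ZJ_eq_piFinset, Fintype.card_piFinset]
  exact Finset.prod_congr rfl fun j _ => card_ZCoord (hN j) (hdvd j)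

theorem sum_pow_ZCoord_eq_zero {p : ℕ} [CharP F p] {j : Fin m} {c : ℕ} (hN : 1 < N j)
    (hdvd : N j - 1 ∣ Fintype.card F - 1) (hpN : j ∉ J → p ∣ N j) (hεc : eps J j ≤ c)
    (hc : c < N j - 1) : ∑ x ∈ ZCoord F N J j, x ^ c = 0 := by
  rcases Nat.eq_zero_or_pos c with rfl | hc0
  · have hj : j ∉ J := fun hj => by simp [eps, hj] at hεc
    have h := card_ZCoord (J := J) hN hdvd
    simp only [pow_zero, Finset.sum_const, nsmul_eq_mul, mul_one, h]
    simpa [eps, hj] using (CharP.cast_eq_zero_iff F p (N j)).mpr (hpN hj)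
  · have h1 := sum_pow_filter_pow_eq_one hdvd hc0 hc
    by_cases hj : j ∈ J
    · simpa [ZCoord, hj] using h1
    · simp only [ZCoord, hj, if_false]
      rw [filter_pow_eq_self hN, Finset.sum_insert
        (zero_notMem_filter_pow_eq_one (Nat.sub_pos_of_lt hN)), h1]
      simp [hc0.ne']

theorem evm_add (a b : Fin m → ℕ) (P : ZJ F N J) :
    evm F N J (a + b) P = evm F N J a P * evm F N J b P := by
  simp [evm, pow_add, Finset.prod_mul_distrib]

theorem evm_smul (k : ℕ) (b : Fin m → ℕ) (P : ZJ F N J) :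
    evm F N J (k • b) P = evm F N J b P ^ k := by
  simp [evm, ← Finset.prod_pow, ← pow_mul, mul_comm]

theorem evm_eps_ne_zero (hN : ∀ j, 1 < N j) (P : ZJ F N J) : evm F N J (eps J) P ≠ 0 := by
  refine Finset.prod_ne_zero_iff.mpr fun j _ => ?_
  by_cases hj : j ∈ J
  · have h : P.1 j ^ (N j - 1) = 1 := ((Finset.mem_filter.mp P.2).2 j).1 hj
    refine pow_ne_zero _ fun h0 => ?_
    rw [h0, zero_pow (Nat.sub_pos_of_lt (hN j)).ne'] at h
    exact zero_ne_one h
  · simp [eps, hj]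

theorem coord_pow_eq (hN : ∀ j, 1 < N j) (P : ZJ F N J) (j : Fin m) :
    P.1 j ^ N j = P.1 j := by
  by_cases hj : j ∈ J
  · have h : P.1 j ^ (N j - 1) = 1 := ((Finset.mem_filter.mp P.2).2 j).1 hj
    rw [← Nat.sub_add_cancel (hN j).le, pow_succ, h, one_mul]
  · exact ((Finset.mem_filter.mp P.2).2 j).2 hj

theorem evm_update_reduce (hN : ∀ j, 1 < N j) {b : Fin m → ℕ} {j : Fin m} (hb : N j - 1 < b j) :
    evm F N J (Function.update b j (b j - (N j - 1))) = evm F N J b := by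
  funext P
  refine Finset.prod_congr rfl fun i _ => ?_
  by_cases hi : i = j
  · subst hi
    rw [Function.update_self]
    have h1 := hN i
    obtain ⟨k, hk⟩ : ∃ k, b i = k + N i := ⟨b i - N i, by omega⟩
    rw [hk, pow_add, coord_pow_eq hN, ← pow_succ]
    congr 1
    omega
  · rw [Function.update_of_ne hi]

theorem eq_zero_of_sum_mul_evm_eq_zero (hN : ∀ j, 1 < N j) {z : ZJ F N J → F}
    (hz : ∀ e, eps J ≤ e → ∑ P, z P * evm F N J e P = 0) : z = 0 := by
  have hpoly : ∀ f : MvPolynomial (Fin m) F,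
      ∑ P, z P * evm F N J (eps J) P * MvPolynomial.eval P.1 f = 0 := by
    intro f
    induction f using MvPolynomial.induction_on' with
    | monomial s a =>
      have h := hz (eps J + s) (by intro j; simp)
      calc _ = a * ∑ P, z P * evm F N J (eps J + s) P := by
            rw [Finset.mul_sum]
            refine Finset.sum_congr rfl fun P _ => ?_
            rw [evm_add, MvPolynomial.eval_monomial, Finsupp.prod_fintype _ _ (by simp)]
            simp only [evm]
            ring
        _ = 0 := by rw [h, mul_zero]
    | add f g hf hg => simp only [map_add, mul_add, Finset.sum_add_distrib, hf, hg, add_zero]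
  funext P₀
  have h := hpoly (MvPolynomial.indicator P₀.1)
  rw [Finset.sum_eq_single P₀, MvPolynomial.eval_indicator_apply_eq_one, mul_one] at h
  · exact (mul_eq_zero.mp h).resolve_right (evm_eps_ne_zero hN P₀)
  · intro P _ hP
    rw [MvPolynomial.eval_indicator_apply_eq_zero _ _ (fun h => hP (Subtype.ext h)), mul_zero]
  · simp

theorem exists_lex_minimal_exponent (hN : ∀ j, 1 < N j) {z : ZJ F N J → F} (hz : z ≠ 0) :
    ∃ b, eps J ≤ b ∧ (∀ j, b j ≤ N j - 1) ∧ ∑ P, z P * evm F N J b P ≠ 0 ∧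
      ∀ e, eps J ≤ e → toLex e < toLex b → ∑ P, z P * evm F N J e P = 0 := by
  have hne : {b : Lex (Fin m → ℕ) | eps J ≤ ofLex b ∧
      ∑ P, z P * evm F N J (ofLex b) P ≠ 0}.Nonempty := by
    by_contra hcon
    refine hz (eq_zero_of_sum_mul_evm_eq_zero hN fun e he => ?_)
    by_contra h
    exact hcon ⟨toLex e, he, h⟩
  obtain ⟨b, ⟨hεb, hb⟩, hmin⟩ := (wellFounded_lt (α := Lex (Fin m → ℕ))).has_min _ hne
  refine ⟨ofLex b, hεb, fun j => ?_, hb, fun e he hlt => ?_⟩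
  · by_contra! hj
    refine hmin (toLex (Function.update (ofLex b) j (ofLex b j - (N j - 1)))) ⟨?_, ?_⟩ ?_
    · intro i
      by_cases hi : i = j
      · subst hi
        have : eps J i ≤ 1 := by unfold eps; split <;> simp
        simp only [ofLex_toLex, Function.update_self]
        omega
      · simpa [Function.update_of_ne hi] using hεb i
    · rwa [ofLex_toLex, evm_update_reduce hN hj]
    · refine Pi.toLex_strictMono (b := ofLex b) (update_lt_self_iff.mpr ?_)
      have := hN j
      omega
  · by_contra h
    exact hmin (toLex e) ⟨he, h⟩ hlt

theorem prod_le_card_support {z : ZJ F N J → F} {b : Fin m → ℕ}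
    (hεb : eps J ≤ b) (hb : ∑ P, z P * evm F N J b P ≠ 0)
    (hlow : ∀ e, eps J ≤ e → toLex e < toLex b → ∑ P, z P * evm F N J e P = 0) :
    ∏ j, (b j + 1 - eps J j) ≤ (Finset.univ.filter (fun P => z P ≠ 0)).card := by
  let S := Finset.univ.filter (fun P => z P ≠ 0)
  let u : Finset.Icc (0 : Fin m → ℕ) (b - eps J) → (S → F) := fun c P => evm F N J c.1 P.1
  have hli : LinearIndependent F u := by
    rw [Fintype.linearIndependent_iff]
    intro g hg
    by_contra! hex
    obtain ⟨c₀, hc₀⟩ := hex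
    obtain ⟨c, hc, hmax⟩ := (Finset.univ.filter (fun c => g c ≠ 0)).exists_max_image
      (fun c => toLex c.1) ⟨c₀, by simpa using hc₀⟩
    have hcb : c.1 ≤ b - eps J := (Finset.mem_Icc.mp c.2).2
    have hshift : eps J ≤ b - c.1 := by
      intro j
      have h1 := hcb j
      have h2 : eps J j ≤ b j := hεb j
      simp only [Pi.sub_apply] at h1 ⊢
      omega
    have hle : c.1 ≤ b := hcb.trans tsub_le_self
    have hpt : ∀ P, z P * ∑ d, g d * evm F N J d.1 P = 0 := by
      intro P
      by_cases hP : z P = 0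
      · rw [hP, zero_mul]
      · have := congrFun hg ⟨P, by simpa [S] using hP⟩
        simp only [Finset.sum_apply, Pi.smul_apply, smul_eq_mul, Pi.zero_apply, u] at this
        rw [this, mul_zero]
    have hsum : ∑ d, g d * ∑ P, z P * evm F N J (d.1 + (b - c.1)) P = 0 := by
      calc _ = ∑ P, (z P * ∑ d, g d * evm F N J d.1 P) * evm F N J (b - c.1) P := by
            simp only [Finset.mul_sum, Finset.sum_mul]
            rw [Finset.sum_comm]
            refine Finset.sum_congr rfl fun P _ => Finset.sum_congr rfl fun d _ => ?_
            rw [evm_add]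
            ring
        _ = 0 := by simp only [hpt, zero_mul, Finset.sum_const_zero]
    rw [Finset.sum_eq_single c, add_tsub_cancel_of_le hle] at hsum
    · exact (mul_ne_zero (Finset.mem_filter.mp hc).2 hb) hsum
    · intro d _ hd
      by_cases hgd : g d = 0
      · rw [hgd, zero_mul]
      · rw [hlow _ (hshift.trans le_add_self), mul_zero]
        have hdc : toLex d.1 < toLex c.1 :=
          lt_of_le_of_ne (hmax d (by simpa using hgd)) fun h => hd (Subtype.ext (toLex.injective h))
        calc toLex (d.1 + (b - c.1)) = toLex d.1 + toLex (b - c.1) := rfl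
          _ < toLex c.1 + toLex (b - c.1) := by gcongr
          _ = toLex (c.1 + (b - c.1)) := rfl
          _ = toLex b := by rw [add_tsub_cancel_of_le hle]
    · simp
  have hcard := hli.fintype_card_le_finrank
  rw [Module.finrank_fintype_fun_eq_card, Fintype.card_coe, Fintype.card_coe, Pi.card_Icc] at hcard
  refine le_trans (le_of_eq (Finset.prod_congr rfl fun j _ => ?_)) hcard
  have : eps J j ≤ b j := hεb j
  simp only [Nat.card_Icc, Pi.sub_apply, Pi.zero_apply]
  omega

theorem span_evm_box_eq_top (hN : ∀ j, 1 < N j) :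
    Submodule.span F (Set.range fun b : Finset.Icc (eps J) (fun j => N j - 1) =>
      evm F N J b.1) = ⊤ := by
  by_contra hne
  obtain ⟨f, hf0, hf⟩ := Submodule.exists_le_ker_of_lt_top _ (lt_top_iff_ne_top.mpr hne)
  have hfx : ∀ x : ZJ F N J → F, f x = ∑ P, f (Pi.single P 1) * x P := by
    intro x
    rw [LinearMap.pi_apply_eq_sum_univ f x]
    refine Finset.sum_congr rfl fun P _ => ?_
    rw [smul_eq_mul, mul_comm]
    congr 2
    funext i
    simp [Pi.single_apply, eq_comm]
  have hz : (fun P : ZJ F N J => f (Pi.single P 1)) ≠ 0 := by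
    intro hz
    refine hf0 (LinearMap.ext fun x => ?_)
    rw [hfx]
    exact Finset.sum_eq_zero fun P _ => by
      rw [show f (Pi.single P 1) = 0 from congrFun hz P, zero_mul]
  obtain ⟨b, hεb, hbN, hb, -⟩ := exists_lex_minimal_exponent hN hz
  refine hb ?_
  rw [← hfx]
  exact hf (Submodule.subset_span ⟨⟨b, Finset.mem_Icc.mpr ⟨hεb, hbN⟩⟩, rfl⟩)

theorem linearIndependent_evm_box (hN : ∀ j, 1 < N j)
    (hdvd : ∀ j, N j - 1 ∣ Fintype.card F - 1) :
    LinearIndependent F fun b : Finset.Icc (eps J) (fun j => N j - 1) => evm F N J b.1 := by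
  refine linearIndependent_of_top_le_span_of_card_eq_finrank (span_evm_box_eq_top hN).ge ?_
  rw [Module.finrank_fintype_fun_eq_card, Fintype.card_coe, Fintype.card_coe, Pi.card_Icc,
    card_ZJ hN hdvd]
  refine Finset.prod_congr rfl fun j _ => ?_
  have := hN j
  rw [Nat.card_Icc]
  omega

theorem finrank_Fcode (hN : ∀ j, 1 < N j) (hdvd : ∀ j, N j - 1 ∣ Fintype.card F - 1) (t : ℕ) :
    Module.finrank F (Fcode F N J t) = Nat.card (NSet N J t) := by
  have hsub : ∀ b ∈ NSet N J t, b ∈ Finset.Icc (eps J) (fun j => N j - 1) := fun b hb =>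
    Finset.mem_Icc.mpr ⟨fun j => (hb.1 j).1, fun j => (hb.1 j).2⟩
  have hinj : Function.Injective fun b : NSet N J t =>
      (⟨b.1, hsub b.1 b.2⟩ : Finset.Icc (eps J) (fun j => N j - 1)) :=
    fun b c h => Subtype.ext (congrArg (fun x => x.1) h)
  have := Fintype.ofInjective _ hinj
  have hspan := finrank_span_eq_card ((linearIndependent_evm_box hN hdvd).comp _ hinj)
  rw [Nat.card_eq_fintype_card, ← hspan, Fcode]
  have hset : {v | ∃ b ∈ NSet N J t, v = evm F N J b} = Set.range
      ((fun b : Finset.Icc (eps J) (fun j => N j - 1) => evm F N J b.1) ∘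
        fun b : NSet N J t => ⟨b.1, hsub b.1 b.2⟩) := by
    ext v
    simp [eq_comm]
  rw [hset]

theorem le_card_support_of_orthogonal_Fcode (hN : ∀ j, 1 < N j) {t : ℕ} {z : ZJ F N J → F}
    (hz : z ≠ 0) (horth : ∀ x ∈ Fcode F N J t, ∑ P, x P * z P = 0) :
    t ≤ (Finset.univ.filter (fun P => z P ≠ 0)).card := by
  obtain ⟨b, hεb, hbN, hb, hlow⟩ := exists_lex_minimal_exponent hN hz
  refine le_trans ?_ (prod_le_card_support hεb hb hlow)
  by_contra! hlt
  refine hb ?_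
  simp only [mul_comm (z _)]
  exact horth _ (Submodule.subset_span ⟨b, ⟨fun j => ⟨hεb j, hbN j⟩, hlt⟩, rfl⟩)

theorem Fcode_hermitian_self_orthogonal {p e : ℕ} [Fact p.Prime] [CharP F p]
    (hN : ∀ j, 1 < N j) (hdvd : ∀ j, N j - 1 ∣ Fintype.card F - 1) (hpN : ∀ j ∉ J, p ∣ N j)
    {t : ℕ} {j : Fin m} (hj : ∀ b ∈ NSet N J t, (p ^ e + 1) * b j < N j - 1) :
    ∀ x ∈ Fcode F N J t, ∀ y ∈ Fcode F N J t, ∑ P, x P * y P ^ p ^ e = 0 := by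
  intro x hx y hy
  have hq : 0 < p ^ e := pow_pos (Fact.out : p.Prime).pos e
  induction hx using Submodule.span_induction with
  | zero => simp
  | add x x' _ _ hx hx' => simp only [Pi.add_apply, add_mul, Finset.sum_add_distrib, hx, hx', add_zero]
  | smul c x _ hx => simp only [Pi.smul_apply, smul_eq_mul, mul_assoc, ← Finset.mul_sum, hx, mul_zero]
  | mem x hx =>
    obtain ⟨a, ha, rfl⟩ := hx
    induction hy using Submodule.span_induction with
    | zero => simp only [Pi.zero_apply, zero_pow hq.ne', mul_zero, Finset.sum_const_zero]
    | add y y' _ _ hy hy' =>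
      simp only [Pi.add_apply, add_pow_char_pow, mul_add, Finset.sum_add_distrib, hy, hy',
        add_zero]
    | smul c y _ hy =>
      simp only [Pi.smul_apply, smul_eq_mul, mul_pow, mul_left_comm _ (c ^ p ^ e),
        ← Finset.mul_sum, hy, mul_zero]
    | mem y hy =>
      obtain ⟨b, hb, rfl⟩ := hy
      simp only [← evm_smul, ← evm_add]
      rw [sum_evm]
      refine Finset.prod_eq_zero (Finset.mem_univ j)
        (sum_pow_ZCoord_eq_zero (p := p) (hN j) (hdvd j) (hpN j) ?_ ?_)
      · exact (ha.1 j).1.trans le_self_add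
      · have h1 := hj a ha
        have h2 := hj b hb
        simp only [Pi.add_apply, Pi.smul_apply, smul_eq_mul]
        rcases le_total (a j) (b j) with h | h
        · nlinarith
        · nlinarith [Nat.mul_le_mul_left (p ^ e) h]

end AffineVariety

theorem mul_lt_of_le_rNq {q n b : ℕ} (hn : 1 < n) (hb : b ≤ rNq q n) : (q + 1) * b < n - 1 := by
  refine (Nat.mul_le_mul_left _ hb).trans_lt ?_
  unfold rNq
  split_ifs with h
  · obtain ⟨k, hk⟩ := h
    rw [hk, Nat.mul_div_cancel_left _ q.succ_pos]
    refine Nat.mul_lt_mul_of_pos_left (Nat.sub_lt (Nat.pos_of_ne_zero ?_) one_pos) q.succ_pos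
    rintro rfl
    omega
  · refine lt_of_le_of_ne (Nat.mul_div_le _ _) fun heq => h ⟨_, heq.symm⟩

theorem add_one_sub_eps_lt_of_mem_NSet {N : Fin 2 → ℕ} {J : Finset (Fin 2)} {t : ℕ}
    {b : Fin 2 → ℕ} (hb : b ∈ NSet N J t) (j : Fin 2) : b j + 1 - eps J j < t := by
  refine lt_of_le_of_lt (Nat.le_of_dvd (Finset.prod_pos fun i _ => ?_)
    (Finset.dvd_prod_of_mem (fun i => b i + 1 - eps J i) (Finset.mem_univ j))) hb.2
  have := (hb.1 i).1
  omega

theorem mul_lt_of_mem_NSet {q : ℕ} {N : Fin 2 → ℕ} (hN : ∀ j, 1 < N j) {J : Finset (Fin 2)}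
    {t : ℕ} {j : Fin 2} (ht : t + eps J j ≤ rNq q (N j) + 2) :
    ∀ b ∈ NSet N J t, (q + 1) * b j < N j - 1 := by
  intro b hb
  have := add_one_sub_eps_lt_of_mem_NSet hb j
  exact mul_lt_of_le_rNq (hN j) (by omega)

/-- Corollary 2 of the paper, bivariate Hermitian case. Under the
displayed conditions on `t` (depending on `J ⊆ {1,2}`), the code `F(J,t)` over
`F_{q^2}` is Hermitian self-orthogonal, has dimension `card N(J,t)`, and its Hermitian
dual has minimum distance at least `t`. -/
theorem Fcode_bivariate_hermitian_self_orthogonal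
    (p e : ℕ) (hp : p.Prime) (he : 0 < e)
    (F : Type) [Field F] [Fintype F] [DecidableEq F]
    (hF : Fintype.card F = (p ^ e) ^ 2)
    (N : Fin 2 → ℕ) (hN : ∀ j, 1 < N j)
    (hNdvd : ∀ j, (N j - 1) ∣ (Fintype.card F - 1))
    (J : Finset (Fin 2)) (hpN : ∀ j ∉ J, p ∣ N j)
    (t : ℕ) (ht : 1 ≤ t) (htn : t ≤ ∏ j, (N j - eps J j))
    (hcases :
      (J = (∅ : Finset (Fin 2)) ∧
        (t ≤ rNq (p ^ e) (N 0) + 2 ∨ t ≤ rNq (p ^ e) (N 1) + 2)) ∨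
      (J = ({0} : Finset (Fin 2)) ∧
        (t ≤ rNq (p ^ e) (N 0) + 1 ∨ t ≤ rNq (p ^ e) (N 1) + 2)) ∨
      (J = ({0, 1} : Finset (Fin 2)) ∧
        (t ≤ rNq (p ^ e) (N 0) + 1 ∨ t ≤ rNq (p ^ e) (N 1) + 1))) :
    (∀ x ∈ Fcode F N J t, ∀ y ∈ Fcode F N J t, ∑ i, x i * y i ^ (p ^ e) = 0) ∧
    Module.finrank F (Fcode F N J t) = Nat.card (NSet N J t) ∧
    (∀ y : ↥(ZJ F N J) → F,
      (∀ x ∈ Fcode F N J t, ∑ i, x i * y i ^ (p ^ e) = 0) → y ≠ 0 →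
      t ≤ (Finset.univ.filter (fun i => y i ≠ 0)).card) := by
  have : Fact p.Prime := ⟨hp⟩
  have : CharP F p := charP_of_card_eq_prime_pow (f := e * 2) (by rw [hF, pow_mul])
  obtain ⟨j, hj⟩ : ∃ j, t + eps J j ≤ rNq (p ^ e) (N j) + 2 := by
    rcases hcases with ⟨rfl, h | h⟩ | ⟨rfl, h | h⟩ | ⟨rfl, h | h⟩
    · exact ⟨0, by simpa [eps] using h⟩
    · exact ⟨1, by simpa [eps] using h⟩
    · exact ⟨0, by simpa [eps] using h⟩
    · exact ⟨1, by simpa [eps] using h⟩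
    · exact ⟨0, by simpa [eps] using h⟩
    · exact ⟨1, by simpa [eps] using h⟩
  refine ⟨Fcode_hermitian_self_orthogonal hN hNdvd hpN (mul_lt_of_mem_NSet hN hj),
    finrank_Fcode hN hNdvd t, fun y hy hy0 => ?_⟩
  have hq : p ^ e ≠ 0 := pow_ne_zero _ hp.ne_zero
  have hz : (fun P => y P ^ p ^ e) ≠ 0 := fun h => hy0 <| funext fun P =>
    eq_zero_of_pow_eq_zero (congrFun h P)
  simpa only [ne_eq, pow_eq_zero_iff hq] using le_card_support_of_orthogonal_Fcode hN hz hy
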